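/- Whenever constants satisfy the hierarchy 0 < 1/n ≪ η' ≪ η, ε, 1/c with c ∈ ℕ, the following holds: let H be a 3-graph on n vertices and let V₁,...,V_d be disjoint subsets of V(H) with 2 ≤ d ≤ 4 such that each Vᵢ is (c,η)-closed in H. Let a₁,...,a_d be non-negative integers with a₁ ≥ 1 and a₁+...+a_d = 4. Suppose there are at least εn⁴ copies F of K₄⁻ in H with |V(F) ∩ Vᵢ| = aᵢ for all i ∈ [d], and at least εn⁴ copies F' of K₄⁻ in H with |V(F') ∩ V₁| = a₁ − 1, |V(F') ∩ V₂| = a₂ + 1 and |V(F') ∩ V_j| = a_j for all 3 ≤ j ≤ d. Then V₁ ∪ V₂ is (5c+1, η')-closed in H. -/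

import Mathlib

open Finset

/-- `H` is the edge set of a 3-uniform hypergraph (3-graph) on `Fin n`. -/
def Is3Graph (n : ℕ) (H : Finset (Finset (Fin n))) : Prop :=
  ∀ e ∈ H, e.card = 3

/-- `degOn H x y U` : number of `z ∈ U` with `{x,y,z} ∈ H`, i.e. `deg_H(xy, U)`. -/
def degOn {n : ℕ} (H : Finset (Finset (Fin n))) (x y : Fin n) (U : Finset (Fin n)) : ℕ :=
  (U.filter fun z => ({x, y, z} : Finset (Fin n)) ∈ H).card

/-- The minimum codegree `δ₂(H)` is at least `t`. -/
def CodegLB {n : ℕ} (H : Finset (Finset (Fin n))) (t : ℝ) : Prop :=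
  ∀ x y : Fin n, x ≠ y → t ≤ (degOn H x y Finset.univ : ℝ)

/-- `S` spans a copy of `K₄⁻` in `H`: it has 4 vertices and at least 3 of its
four 3-subsets are edges. -/
def SpansK4m {n : ℕ} (H : Finset (Finset (Fin n))) (S : Finset (Fin n)) : Prop :=
  S.card = 4 ∧ 3 ≤ ((S.powersetCard 3).filter (· ∈ H)).card

/-- `S` spans a copy of `K₄³` (the complete 3-graph on 4 vertices) in `H`. -/
def SpansK43 {n : ℕ} (H : Finset (Finset (Fin n))) (S : Finset (Fin n)) : Prop :=
  S.card = 4 ∧ ((S.powersetCard 3).filter (· ∈ H)).card = 4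

/-- The induced subgraph `H[X]` contains a `K₄⁻`-factor. -/
def HasK4mFactorOn {n : ℕ} (H : Finset (Finset (Fin n))) (X : Finset (Fin n)) : Prop :=
  ∃ P : Finset (Finset (Fin n)),
    (∀ S ∈ P, SpansK4m H S) ∧
    (∀ S ∈ P, ∀ T ∈ P, S ≠ T → Disjoint S T) ∧
    P.biUnion id = X

/-- `S` is an `(x,y)`-connector of length `c` in `H`. -/
def IsConnector {n : ℕ} (H : Finset (Finset (Fin n))) (c : ℕ) (x y : Fin n)
    (S : Finset (Fin n)) : Prop :=
  x ∉ S ∧ y ∉ S ∧ S.card = 4 * c - 1 ∧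
    HasK4mFactorOn H (insert x S) ∧ HasK4mFactorOn H (insert y S)

/-- `x` and `y` are `(c,η)`-close in `H` (a 3-graph on `n` vertices). -/
def Close {n : ℕ} (H : Finset (Finset (Fin n))) (c : ℕ) (η : ℝ) (x y : Fin n) : Prop :=
  η * (n : ℝ) ^ (4 * c - 1) ≤ ({S : Finset (Fin n) | IsConnector H c x y S}.ncard : ℝ)

/-- `U` is `(c,η)`-closed in `H`. -/
def ClosedOn {n : ℕ} (H : Finset (Finset (Fin n))) (c : ℕ) (η : ℝ)
    (U : Finset (Fin n)) : Prop :=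
  ∀ x ∈ U, ∀ y ∈ U, x ≠ y → Close H c η x y

/-- The number of `(X,Y)`-bridges `(x,y,S)` of length `c` in `H`. -/
noncomputable def BridgeCount {n : ℕ} (H : Finset (Finset (Fin n))) (c : ℕ)
    (X Y : Finset (Fin n)) : ℕ :=
  {t : Fin n × Fin n × Finset (Fin n) |
    t.1 ∈ X ∧ t.2.1 ∈ Y ∧ IsConnector H c t.1 t.2.1 t.2.2}.ncard

/-- The 3-graph `𝓑[A,B]`: all triples in `A ∪ B` containing an odd number of
vertices of `A`. -/
def BGraph {n : ℕ} (A B : Finset (Fin n)) : Finset (Finset (Fin n)) :=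
  ((A ∪ B).powersetCard 3).filter fun e => (e ∩ A).card % 2 = 1

/-- `H` (a 3-graph on `n` vertices) is `γ`-extremal. -/
def IsExtremal {n : ℕ} (H : Finset (Finset (Fin n))) (γ : ℝ) : Prop :=
  ∃ A B : Finset (Fin n), Disjoint A B ∧ A ∪ B = Finset.univ ∧
    A.card = n / 2 ∧ B.card = n - n / 2 ∧
    ((BGraph A B \ H).card : ℝ) ≤ γ * (n : ℝ) ^ 3

/-- The number of `V₁V₂V₃`-edges of `H`. -/
def eCount {n : ℕ} (H : Finset (Finset (Fin n))) (A B C : Finset (Fin n)) : ℕ :=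
  (H.filter fun e => ∃ a ∈ A, ∃ b ∈ B, ∃ c ∈ C, e = {a, b, c}).card

/-- `Ñ_{c,η}(x)` : the set of vertices `(c,η)`-close to `x` in `H`. -/
def Ntilde {n : ℕ} (H : Finset (Finset (Fin n))) (c : ℕ) (η : ℝ) (x : Fin n) :
    Set (Fin n) :=
  {y | y ≠ x ∧ Close H c η x y}

/-- The triple `{x,x',y}` is `(ρ,X,Y)`-typical. -/
def TypicalTriple {n : ℕ} (H : Finset (Finset (Fin n))) (ρ : ℝ) (X Y : Finset (Fin n))
    (x x' y : Fin n) : Prop :=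
  (Y.card : ℝ) - ρ * n ≤ (degOn H x x' Y : ℝ) ∧
  (((X.filter fun z => ({x, y, z} : Finset (Fin n)) ∈ H ∧
      ({x', y, z} : Finset (Fin n)) ∈ H).card : ℝ) ≤ ρ * n) ∧
  (X.card : ℝ) - ρ * n ≤ (degOn H x y X : ℝ) + (degOn H x' y X : ℝ)

/-- `Q` spans an `(X,Y)`-bridge of length 1, i.e. `Q = {a,b} ∪ S` for some
`(X,Y)`-bridge `(a,b,S)` of length 1. -/
def SpansBridge1 {n : ℕ} (H : Finset (Finset (Fin n))) (X Y Q : Finset (Fin n)) : Prop :=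
  ∃ a ∈ X, ∃ b ∈ Y, ∃ S : Finset (Fin n), IsConnector H 1 a b S ∧
    Q = insert a (insert b S)

lemma meet_card {n : ℕ} (l : ℕ) (W : Finset (Fin n)) :
    (((univ : Finset (Fin n)).powersetCard (l + 1)).filter (fun B => ¬ Disjoint B W)).card
      ≤ W.card * n ^ l := by
  have h1 : ((univ : Finset (Fin n)).powersetCard (l + 1)).filter (fun B => ¬ Disjoint B W)
      ⊆ W.biUnion (fun w => ((univ : Finset (Fin n)).powersetCard l).image (fun T => insert w T)) := by
    intro B hB
    rw [mem_filter, mem_powersetCard, Finset.not_disjoint_iff] at hB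
    obtain ⟨⟨_, hc⟩, w, hwB, hwW⟩ := hB
    rw [mem_biUnion]
    refine ⟨w, hwW, mem_image.2 ⟨B.erase w, ?_, Finset.insert_erase hwB⟩⟩
    rw [mem_powersetCard]
    refine ⟨subset_univ _, ?_⟩
    rw [Finset.card_erase_of_mem hwB, hc]; rfl
  refine (card_le_card h1).trans ?_
  refine Finset.card_biUnion_le_card_mul _ _ _ ?_
  intro w _
  refine Finset.card_image_le.trans ?_
  rw [card_powersetCard, card_univ, Fintype.card_fin]
  exact Nat.choose_le_pow n l

lemma step_lemma (k l : ℕ) (hl : 0 < l) (α β : ℝ) (hα : 0 < α) (hβ : 0 < β) :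
    ∃ γ : ℝ, 0 < γ ∧ ∃ n₀ : ℕ, ∀ n : ℕ, n₀ ≤ n → ∀ W : Finset (Fin n), W.card ≤ 2 →
      ∀ (P : Finset (Fin n) → Prop) (Q : Finset (Fin n) → Finset (Fin n) → Prop),
        (∀ A, P A → A.card = k) → (∀ A B, P A → Q A B → B.card = l) →
        α * (n : ℝ) ^ k ≤ ({A | P A}.ncard : ℝ) →
        (∀ A, P A → β * (n : ℝ) ^ l ≤ ({B | Q A B}.ncard : ℝ)) →
        γ * (n : ℝ) ^ (k + l) ≤
          ({C | ∃ A B, P A ∧ Q A B ∧ Disjoint B A ∧ Disjoint B W ∧ C = A ∪ B}.ncard : ℝ) := by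
  classical
  obtain ⟨m, rfl⟩ : ∃ m, l = m + 1 := ⟨l - 1, by omega⟩
  refine ⟨α * (β / 2) / 2 ^ (k + (m + 1)), by positivity, ⌈2 * (k + 2 : ℝ) / β⌉₊, ?_⟩
  intro n hn W hW P Q hPk hQl hP hQ
  have hn' : 2 * (k + 2 : ℝ) / β ≤ n := (Nat.le_ceil _).trans (by exact_mod_cast hn)
  have hn2 : (k + 2 : ℝ) ≤ β / 2 * n := by
    rw [div_le_iff₀ hβ] at hn'; linarith
  let 𝒜 : Finset (Finset (Fin n)) := univ.filter P
  let ℬ : Finset (Fin n) → Finset (Finset (Fin n)) := fun A =>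
    univ.filter (fun B => Q A B ∧ Disjoint B (A ∪ W))
  have hA : α * (n : ℝ) ^ k ≤ (𝒜.card : ℝ) := by
    have : {A | P A} = (𝒜 : Set (Finset (Fin n))) := by ext; simp [𝒜]
    rwa [this, Set.ncard_coe_finset] at hP
  have hB : ∀ A ∈ 𝒜, β / 2 * (n : ℝ) ^ (m + 1) ≤ ((ℬ A).card : ℝ) := by
    intro A hA
    have hPA : P A := (mem_filter.1 hA).2
    have h1 := hQ A hPA
    have e : {B | Q A B} = ((univ.filter (Q A) : Finset (Finset (Fin n))) : Set (Finset (Fin n))) := by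
      ext; simp
    rw [e, Set.ncard_coe_finset] at h1
    have hsub : (univ.filter (Q A) : Finset (Finset (Fin n))) ⊆ ℬ A ∪
        ((univ : Finset (Fin n)).powersetCard (m + 1)).filter (fun B => ¬ Disjoint B (A ∪ W)) := by
      intro B hB
      have hq := (mem_filter.1 hB).2
      by_cases hd : Disjoint B (A ∪ W)
      · exact mem_union_left _ (mem_filter.2 ⟨mem_univ _, hq, hd⟩)
      · exact mem_union_right _ (mem_filter.2
          ⟨mem_powersetCard.2 ⟨subset_univ _, hQl A B hPA hq⟩, hd⟩)
    have h2 := (card_le_card hsub).trans (card_union_le _ _)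
    have h3 := meet_card m (A ∪ W)
    have h4 : (A ∪ W).card ≤ k + 2 :=
      (card_union_le _ _).trans (by have := hPk A hPA; omega)
    have h5 : (univ.filter (Q A) : Finset (Finset (Fin n))).card ≤ (ℬ A).card + (k + 2) * n ^ m :=
      h2.trans (Nat.add_le_add_left (h3.trans (Nat.mul_le_mul_right _ h4)) _)
    have h6 : ((univ.filter (Q A) : Finset (Finset (Fin n))).card : ℝ)
        ≤ (ℬ A).card + (k + 2) * (n : ℝ) ^ m := by exact_mod_cast h5
    have h7 : (k + 2) * (n : ℝ) ^ m ≤ β / 2 * n * (n : ℝ) ^ m :=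
      mul_le_mul_of_nonneg_right hn2 (by positivity)
    have h8 : β / 2 * n * (n : ℝ) ^ m = β / 2 * (n : ℝ) ^ (m + 1) := by ring
    have h9 : β * (n : ℝ) ^ (m + 1) = β / 2 * (n : ℝ) ^ (m + 1) + β / 2 * (n : ℝ) ^ (m + 1) := by ring
    linarith
  let PP : Finset (Σ _ : Finset (Fin n), Finset (Fin n)) := 𝒜.sigma ℬ
  let f : (Σ _ : Finset (Fin n), Finset (Fin n)) → Finset (Fin n) := fun t => t.1 ∪ t.2
  have hfac : ∀ t ∈ PP, P t.1 ∧ Q t.1 t.2 ∧ Disjoint t.2 t.1 ∧ Disjoint t.2 W := by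
    intro t ht
    rw [mem_sigma] at ht
    have h1 := (mem_filter.1 ht.1).2
    have h2 := (mem_filter.1 ht.2).2
    exact ⟨h1, h2.1, (disjoint_union_right.1 h2.2).1, (disjoint_union_right.1 h2.2).2⟩
  have hfib : PP.card ≤ 2 ^ (k + (m + 1)) * (PP.image f).card := by
    refine Finset.card_le_mul_card_image _ _ ?_
    intro C hC
    obtain ⟨t, ht, rfl⟩ := mem_image.1 hC
    have hcard : (f t).card = k + (m + 1) := by
      obtain ⟨h1, h2, h3, h4⟩ := hfac t ht
      change (t.1 ∪ t.2).card = _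
      rw [card_union_of_disjoint h3.symm, hPk _ h1, hQl _ _ h1 h2]
    rw [← hcard, ← card_powerset]
    refine Finset.card_le_card_of_injOn (fun s => s.1) ?_ ?_
    · intro s hs
      have hs := (mem_filter.1 hs).2
      simp only [coe_powerset, Set.mem_preimage, Set.mem_powerset_iff, coe_subset]
      rw [← hs]
      exact subset_union_left
    · rintro ⟨a, b⟩ hs ⟨a', b'⟩ hs' h
      have hs := mem_filter.1 hs
      have hs' := mem_filter.1 hs'
      have d := (hfac _ hs.1).2.2.1
      have d' := (hfac _ hs'.1).2.2.1
      simp only at h d d'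
      subst h
      have e : a ∪ b = a ∪ b' := hs.2.trans hs'.2.symm
      have : b = b' := by
        have := congrArg (fun z => z \ a) e
        simp only [union_sdiff_left] at this
        rwa [sdiff_eq_self_of_disjoint d, sdiff_eq_self_of_disjoint d'] at this
      rw [this]
  have hPc : α * (n : ℝ) ^ k * (β / 2 * (n : ℝ) ^ (m + 1)) ≤ (PP.card : ℝ) := by
    rw [card_sigma, Nat.cast_sum]
    calc α * (n : ℝ) ^ k * (β / 2 * (n : ℝ) ^ (m + 1))
        ≤ 𝒜.card * (β / 2 * (n : ℝ) ^ (m + 1)) := mul_le_mul_of_nonneg_right hA (by positivity)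
      _ = ∑ A ∈ 𝒜, (β / 2 * (n : ℝ) ^ (m + 1)) := by rw [sum_const, nsmul_eq_mul]
      _ ≤ _ := sum_le_sum hB
  have hfin : (PP.image f).card ≤
      {C | ∃ A B, P A ∧ Q A B ∧ Disjoint B A ∧ Disjoint B W ∧ C = A ∪ B}.ncard := by
    rw [← Set.ncard_coe_finset]
    refine Set.ncard_le_ncard ?_ (Set.toFinite _)
    intro C hC
    obtain ⟨t, ht, rfl⟩ := mem_image.1 (mem_coe.1 hC)
    obtain ⟨h1, h2, h3, h4⟩ := hfac t ht
    exact ⟨t.1, t.2, h1, h2, h3, h4, rfl⟩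
  have h1 : (PP.card : ℝ) ≤ 2 ^ (k + (m + 1)) * ((PP.image f).card : ℝ) := by exact_mod_cast hfib
  have h2 : ((PP.image f).card : ℝ) ≤
    ({C | ∃ A B, P A ∧ Q A B ∧ Disjoint B A ∧ Disjoint B W ∧ C = A ∪ B}.ncard : ℝ) := by
      exact_mod_cast hfin
  refine le_trans ?_ h2
  rw [div_mul_eq_mul_div, div_le_iff₀ (by positivity)]
  calc _ = α * (n : ℝ) ^ k * (β / 2 * (n : ℝ) ^ (m + 1)) := by ring
    _ ≤ _ := hPc.trans (h1.trans (le_of_eq (mul_comm _ _)))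

lemma ncard_mono' {n : ℕ} {P Q : Finset (Fin n) → Prop} (h : ∀ C, P C → Q C) :
    ({C | P C}.ncard : ℝ) ≤ ({C | Q C}.ncard : ℝ) := by
  exact_mod_cast Set.ncard_le_ncard (fun C hC => h C hC) (Set.toFinite _)

lemma HasK4mFactorOn.union {n : ℕ} {H : Finset (Finset (Fin n))} {X Y : Finset (Fin n)}
    (hX : HasK4mFactorOn H X) (hY : HasK4mFactorOn H Y) (hd : Disjoint X Y) :
    HasK4mFactorOn H (X ∪ Y) := by
  classical
  obtain ⟨P, hP1, hP2, rfl⟩ := hX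
  obtain ⟨Q, hQ1, hQ2, rfl⟩ := hY
  have key : ∀ S ∈ P, ∀ T ∈ Q, Disjoint S T := fun S hS T hT =>
    disjoint_of_subset_left (subset_biUnion_of_mem id hS)
      (disjoint_of_subset_right (subset_biUnion_of_mem id hT) hd)
  refine ⟨P ∪ Q, ?_, ?_, union_biUnion⟩
  · intro S hS
    rcases mem_union.1 hS with h | h
    · exact hP1 S h
    · exact hQ1 S h
  · intro S hS T hT hne
    rcases mem_union.1 hS with h | h <;> rcases mem_union.1 hT with h' | h'
    · exact hP2 S h T h' hne
    · exact key S h T h'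
    · exact (key T h' S h).symm
    · exact hQ2 S h T h' hne

lemma SpansK4m.factor {n : ℕ} {H : Finset (Finset (Fin n))} {X : Finset (Fin n)}
    (hX : SpansK4m H X) : HasK4mFactorOn H X := by
  refine ⟨{X}, ?_, ?_, ?_⟩
  · intro S hS; rw [mem_singleton.1 hS]; exact hX
  · intro S hS T hT h; rw [mem_singleton.1 hS, mem_singleton.1 hT] at h; exact absurd rfl h
  · simp

/-- `X` and `Y` have factors after removing `r` suitably paired vertices. -/
def PairExt {n : ℕ} (H : Finset (Finset (Fin n))) (c : ℕ) (η : ℝ) :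
    ℕ → Finset (Fin n) → Finset (Fin n) → Prop
  | 0, X, Y => HasK4mFactorOn H X ∧ HasK4mFactorOn H Y
  | r + 1, X, Y => ∃ p ∈ X, ∃ q ∈ Y, Close H c η p q ∧ PairExt H c η r (X.erase p) (Y.erase q)

lemma PairExt.insert {n : ℕ} {H : Finset (Finset (Fin n))} {c : ℕ} {η : ℝ} {r : ℕ}
    {X Y : Finset (Fin n)} (h : PairExt H c η r X Y) {p q : Fin n} (hp : p ∉ X) (hq : q ∉ Y)
    (hpq : Close H c η p q) : PairExt H c η (r + 1) (insert p X) (insert q Y) := by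
  refine ⟨p, mem_insert_self _ _, q, mem_insert_self _ _, hpq, ?_⟩
  rwa [erase_insert hp, erase_insert hq]

lemma PairExt.union {n : ℕ} {H : Finset (Finset (Fin n))} {c : ℕ} {η : ℝ} {r : ℕ} :
    ∀ {X Y A B : Finset (Fin n)}, PairExt H c η r X Y → Disjoint X A → Disjoint Y B →
      HasK4mFactorOn H A → HasK4mFactorOn H B → PairExt H c η r (X ∪ A) (Y ∪ B) := by
  induction r with
  | zero =>
    intro X Y A B h hXA hYB hA hB
    exact ⟨h.1.union hA hXA, h.2.union hB hYB⟩
  | succ r ih =>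
    intro X Y A B h hXA hYB hA hB
    obtain ⟨p, hp, q, hq, hpq, h⟩ := h
    refine ⟨p, mem_union_left _ hp, q, mem_union_left _ hq, hpq, ?_⟩
    have h1 : p ∉ A := disjoint_left.1 hXA hp
    have h2 : q ∉ B := disjoint_left.1 hYB hq
    rw [erase_union_distrib, erase_union_distrib, erase_eq_of_notMem h1, erase_eq_of_notMem h2]
    exact ih h (disjoint_of_subset_left (erase_subset _ _) hXA)
      (disjoint_of_subset_left (erase_subset _ _) hYB) hA hB

lemma ext_iter (c : ℕ) (hc : 0 < c) (η : ℝ) (hη : 0 < η) (r : ℕ) : ∀ (k : ℕ) (α : ℝ), 0 < α →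
    ∃ γ : ℝ, 0 < γ ∧ ∃ n₀ : ℕ, ∀ n : ℕ, n₀ ≤ n → ∀ (H : Finset (Finset (Fin n))) (x y : Fin n),
      α * (n : ℝ) ^ k ≤ ({C : Finset (Fin n) | C.card = k ∧ x ∉ C ∧ y ∉ C ∧
        PairExt H c η r (insert x C) (insert y C)}.ncard : ℝ) →
      γ * (n : ℝ) ^ (k + r * (4 * c - 1)) ≤ ({C : Finset (Fin n) | C.card = k + r * (4 * c - 1) ∧
        x ∉ C ∧ y ∉ C ∧ PairExt H c η 0 (insert x C) (insert y C)}.ncard : ℝ) := by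
  classical
  induction r with
  | zero =>
    intro k α hα
    refine ⟨α, hα, 0, ?_⟩
    intro n _ H x y h
    simpa using h
  | succ r ih =>
    intro k α hα
    obtain ⟨γ₁, hγ₁, n₁, h1⟩ := step_lemma k (4 * c - 1) (by omega) α η hα hη
    obtain ⟨γ, hγ, n₂, h2⟩ := ih (k + (4 * c - 1)) γ₁ hγ₁
    refine ⟨γ, hγ, max n₁ n₂, ?_⟩
    intro n hn H x y h
    have e : k + (r + 1) * (4 * c - 1) = k + (4 * c - 1) + r * (4 * c - 1) := by ring
    rw [e]
    refine h2 n (le_of_max_le_right hn) H x y ?_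
    let P : Finset (Fin n) → Prop := fun C => C.card = k ∧ x ∉ C ∧ y ∉ C ∧
        PairExt H c η (r + 1) (insert x C) (insert y C)
    have hch : ∀ C, ∃ p q, P C → p ∈ insert x C ∧ q ∈ insert y C ∧ Close H c η p q ∧
        PairExt H c η r ((insert x C).erase p) ((insert y C).erase q) := by
      intro C
      by_cases hC : P C
      · obtain ⟨p, hp, q, hq, h⟩ := hC.2.2.2
        exact ⟨p, q, fun _ => ⟨hp, hq, h⟩⟩
      · exact ⟨x, y, fun h => absurd h hC⟩
    choose p q hpq using hch
    refine (h1 n (le_of_max_le_left hn) {x, y} card_le_two P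
      (fun A B => IsConnector H c (p A) (q A) B) (fun A hA => hA.1) (fun A B _ hB => hB.2.2.1) h
      (fun A hA => (hpq A hA).2.2.1)).trans (ncard_mono' ?_)
    rintro C ⟨A, B, hPA, hB, hBA, hBW, rfl⟩
    obtain ⟨hp, hq, -, hE⟩ := hpq A hPA
    obtain ⟨hAk, hxA, hyA, -⟩ := hPA
    obtain ⟨hpB, hqB, hBc, hf1, hf2⟩ := hB
    have hxB : x ∉ B := fun h => disjoint_left.1 hBW h (by simp)
    have hyB : y ∉ B := fun h => disjoint_left.1 hBW h (by simp)
    have hBx : Disjoint B (insert x A) := disjoint_insert_right.2 ⟨hxB, hBA⟩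
    have hBy : Disjoint B (insert y A) := disjoint_insert_right.2 ⟨hyB, hBA⟩
    refine ⟨by rw [card_union_of_disjoint hBA.symm, hAk, hBc], by simp [hxA, hxB],
      by simp [hyA, hyB], ?_⟩
    have := hE.union (A := insert (p A) B) (B := insert (q A) B)
      (disjoint_insert_right.2 ⟨notMem_erase _ _,
        disjoint_of_subset_left (erase_subset _ _) hBx.symm⟩)
      (disjoint_insert_right.2 ⟨notMem_erase _ _,
        disjoint_of_subset_left (erase_subset _ _) hBy.symm⟩) hf1 hf2
    rwa [union_insert, ← insert_union, insert_erase hp, union_insert, ← insert_union,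
      insert_erase hq, insert_union, insert_union] at this

lemma conn_iter (c : ℕ) (hc : 0 < c) (η ε : ℝ) (hη : 0 < η) (hε : 0 < ε) (j : ℕ) :
    ∃ γ : ℝ, 0 < γ ∧ ∃ n₀ : ℕ, ∀ n : ℕ, n₀ ≤ n → ∀ (H : Finset (Finset (Fin n))) (x y : Fin n),
      Close H c η x y → ε * (n : ℝ) ^ 4 ≤ ({S : Finset (Fin n) | SpansK4m H S}.ncard : ℝ) →
      Close H (c + j) γ x y := by
  classical
  induction j with
  | zero => exact ⟨η, hη, 0, fun n _ H x y h _ => h⟩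
  | succ j ih =>
    obtain ⟨γ₁, hγ₁, n₁, h1⟩ := ih
    obtain ⟨γ, hγ, n₂, h2⟩ := step_lemma (4 * (c + j) - 1) 4 (by omega) γ₁ ε hγ₁ hε
    refine ⟨γ, hγ, max n₁ n₂, ?_⟩
    intro n hn H x y hxy hS
    have h3 := h1 n (le_of_max_le_left hn) H x y hxy hS
    unfold Close
    have e : 4 * (c + (j + 1)) - 1 = 4 * (c + j) - 1 + 4 := by omega
    rw [e]
    refine (h2 n (le_of_max_le_right hn) {x, y} card_le_two (IsConnector H (c + j) x y)
      (fun _ B => SpansK4m H B) (fun A hA => hA.2.2.1) (fun A B _ hB => hB.1) h3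
      (fun A hA => hS)).trans (ncard_mono' ?_)
    rintro C ⟨A, B, hA, hB, hBA, hBW, rfl⟩
    obtain ⟨hxA, hyA, hAc, hf1, hf2⟩ := hA
    have hxB : x ∉ B := fun h => disjoint_left.1 hBW h (by simp)
    have hyB : y ∉ B := fun h => disjoint_left.1 hBW h (by simp)
    refine ⟨by simp [hxA, hxB], by simp [hyA, hyB], ?_, ?_, ?_⟩
    · rw [card_union_of_disjoint hBA.symm, hAc, hB.1, e]
    · rw [← insert_union]
      exact hf1.union hB.factor (disjoint_insert_left.2 ⟨hxB, hBA.symm⟩)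
    · rw [← insert_union]
      exact hf2.union hB.factor (disjoint_insert_left.2 ⟨hyB, hBA.symm⟩)

lemma Close.symm {n : ℕ} {H : Finset (Finset (Fin n))} {c : ℕ} {η : ℝ} {x y : Fin n}
    (h : Close H c η x y) : Close H c η y x := by
  refine le_trans h (ncard_mono' ?_)
  rintro C ⟨h1, h2, h3, h4, h5⟩
  exact ⟨h2, h1, h3, h5, h4⟩

lemma Close.mono {n : ℕ} {H : Finset (Finset (Fin n))} {c : ℕ} {η η' : ℝ} {x y : Fin n}
    (h : Close H c η x y) (hη : η' ≤ η) : Close H c η' x y :=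
  le_trans (mul_le_mul_of_nonneg_right hη (by positivity)) h

lemma ext_pair {n : ℕ} {H : Finset (Finset (Fin n))} {c : ℕ} {η : ℝ} {d : ℕ}
    {V : Fin d → Finset (Fin n)} (hV : ∀ i, ClosedOn H c η (V i))
    (hdis : ∀ i j, i ≠ j → Disjoint (V i) (V j)) {X Y : Finset (Fin n)}
    (h0 : PairExt H c η 0 X Y) (r : ℕ) : ∀ A B : Finset (Fin n), A.card = r → 
      (∀ v ∈ A, ∃ i, v ∈ V i) → (∀ i, (A ∩ V i).card = (B ∩ V i).card) → Disjoint A B →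
      B.card = r → Disjoint X A → Disjoint Y B → PairExt H c η r (X ∪ A) (Y ∪ B) := by
  classical
  induction r with
  | zero =>
    intro A B hA _ _ _ hB _ _
    rw [card_eq_zero] at hA hB
    subst hA hB
    simpa using h0
  | succ r ih =>
    intro A B hA hAV hAB hd hB hXA hYB
    obtain ⟨p, hp⟩ : A.Nonempty := card_pos.1 (by omega)
    obtain ⟨i, hi⟩ := hAV p hp
    obtain ⟨q, hq⟩ : (B ∩ V i).Nonempty := by
      rw [← card_pos, ← hAB i, card_pos]
      exact ⟨p, mem_inter.2 ⟨hp, hi⟩⟩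
    rw [mem_inter] at hq
    have hne : p ≠ q := fun h => disjoint_left.1 hd hp (h ▸ hq.1)
    have h1 := ih (A.erase p) (B.erase q) (by rw [card_erase_of_mem hp, hA]; rfl)
      (fun v hv => hAV v (mem_of_mem_erase hv)) ?_
      (disjoint_of_subset_left (erase_subset _ _) (disjoint_of_subset_right (erase_subset _ _) hd))
      (by rw [card_erase_of_mem hq.1, hB]; rfl)
      (disjoint_of_subset_right (erase_subset _ _) hXA)
      (disjoint_of_subset_right (erase_subset _ _) hYB)
    · have h2 := h1.insert (p := p) (q := q)
        (by simp [disjoint_right.1 hXA hp]) (by simp [disjoint_right.1 hYB hq.1])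
        (hV i p hi q hq.2 hne)
      rwa [← union_insert, ← union_insert, insert_erase hp, insert_erase hq.1] at h2
    · intro j
      rw [erase_inter, erase_inter]
      by_cases hj : j = i
      · subst hj
        rw [card_erase_of_mem (mem_inter.2 ⟨hp, hi⟩), card_erase_of_mem (mem_inter.2 hq), hAB]
      · rw [erase_eq_of_notMem, erase_eq_of_notMem, hAB]
        · exact fun h => disjoint_left.1 (hdis j i hj) (mem_inter.1 h).2 hq.2
        · exact fun h => disjoint_left.1 (hdis j i hj) (mem_inter.1 h).2 hi

lemma cover_of_card {n d : ℕ} {V : Fin d → Finset (Fin n)}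
    (hdis : ∀ i j, i ≠ j → Disjoint (V i) (V j)) {S : Finset (Fin n)}
    (h : S.card ≤ ∑ i, (S ∩ V i).card) : ∀ v ∈ S, ∃ i, v ∈ V i := by
  classical
  have h1 : (univ.biUnion (fun i => S ∩ V i)).card = ∑ i, (S ∩ V i).card := by
    apply card_biUnion
    intro i _ j _ hij
    exact disjoint_of_subset_left inter_subset_right
      (disjoint_of_subset_right inter_subset_right (hdis i j hij))
  have h2 : univ.biUnion (fun i => S ∩ V i) ⊆ S :=
    biUnion_subset.2 fun i _ => inter_subset_left
  have h3 := eq_of_subset_of_card_le h2 (by rw [h1]; exact h)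
  intro v hv
  rw [← h3, mem_biUnion] at hv
  obtain ⟨i, _, hi⟩ := hv
  exact ⟨i, (mem_inter.1 hi).2⟩

/-- The starting configuration built from two disjoint copies of `K₄⁻`. -/
lemma ext_start {n : ℕ} {H : Finset (Finset (Fin n))} {c : ℕ} {η : ℝ} {d : ℕ}
    {V : Fin d → Finset (Fin n)} (hV : ∀ i, ClosedOn H c η (V i))
    (hdis : ∀ i j, i ≠ j → Disjoint (V i) (V j)) {a : Fin d → ℕ} {i₀ i₁ : Fin d} (h01 : i₀ ≠ i₁)
    (ha0 : 1 ≤ a i₀) (hsum : ∑ i, a i = 4) {F F' : Finset (Fin n)}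
    (hF : SpansK4m H F) (hFa : ∀ i, (F ∩ V i).card = a i) (hF' : SpansK4m H F')
    (h0 : (F' ∩ V i₀).card = a i₀ - 1) (h1 : (F' ∩ V i₁).card = a i₁ + 1)
    (h2 : ∀ i, i ≠ i₀ → i ≠ i₁ → (F' ∩ V i).card = a i) (hFF : Disjoint F F')
    {x y : Fin n} (hxy : x ≠ y) (hx : x ∈ V i₀) (hy : y ∈ V i₁) (hxF : x ∉ F) (hxF' : x ∉ F')
    (hyF : y ∉ F) (hyF' : y ∉ F') :
    PairExt H c η 5 (insert x (F ∪ F')) (insert y (F ∪ F')) := by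
  classical
  obtain ⟨u, hu⟩ : (F ∩ V i₀).Nonempty := card_pos.1 (by rw [hFa]; omega)
  obtain ⟨w, hw⟩ : (F' ∩ V i₁).Nonempty := card_pos.1 (by omega)
  have hu' := mem_inter.1 hu
  have hw' := mem_inter.1 hw
  have hcov := cover_of_card hdis (S := F) (by simp_rw [hFa]; rw [hsum, hF.1])
  have hcounts : ∀ i, ((F.erase u) ∩ V i).card = ((F'.erase w) ∩ V i).card := by
    intro i
    rw [erase_inter, erase_inter]
    by_cases hi0 : i = i₀
    · subst hi0
      rw [card_erase_of_mem hu, erase_eq_of_notMem, hFa, h0]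
      exact fun h => disjoint_left.1 (hdis _ _ h01) (mem_inter.1 h).2 hw'.2
    · have hu0 : u ∉ F ∩ V i :=
        fun h => disjoint_left.1 (hdis _ _ hi0) (mem_inter.1 h).2 hu'.2
      rw [erase_eq_of_notMem hu0, hFa]
      by_cases hi1 : i = i₁
      · subst hi1
        rw [card_erase_of_mem hw, h1]; rfl
      · rw [erase_eq_of_notMem, h2 i hi0 hi1]
        exact fun h => disjoint_left.1 (hdis _ _ hi1) (mem_inter.1 h).2 hw'.2
  have hcov' : ∀ v ∈ F'.erase w, ∃ i, v ∈ V i := by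
    refine cover_of_card hdis ?_
    have hsub : ∑ i, ((F'.erase w) ∩ V i).card = ((F.erase u).card) := by
      rw [← Finset.sum_congr rfl (fun i _ => hcounts i), ← card_biUnion]
      · congr 1
        ext v
        simp only [mem_biUnion, mem_univ, true_and, mem_inter]
        constructor
        · rintro ⟨i, h, -⟩; exact h
        · intro h
          obtain ⟨i, hi⟩ := hcov v (mem_of_mem_erase h)
          exact ⟨i, h, hi⟩
      · intro i _ j _ hij
        exact disjoint_of_subset_left inter_subset_right
          (disjoint_of_subset_right inter_subset_right (hdis i j hij))
    rw [hsub, card_erase_of_mem hu'.1, card_erase_of_mem hw'.1, hF.1, hF'.1]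
  have hE := ext_pair hV hdis (X := F) (Y := F') ⟨hF.factor, hF'.factor⟩ 3 (F'.erase w) (F.erase u)
    (by rw [card_erase_of_mem hw'.1, hF'.1]) hcov' (fun i => (hcounts i).symm)
    (disjoint_of_subset_left (erase_subset _ _)
      (disjoint_of_subset_right (erase_subset _ _) hFF.symm))
    (by rw [card_erase_of_mem hu'.1, hF.1])
    (disjoint_of_subset_right (erase_subset _ _) hFF)
    (disjoint_of_subset_right (erase_subset _ _) hFF.symm)
  have hwF : w ∉ F := disjoint_right.1 hFF hw'.1
  have huF' : u ∉ F' := disjoint_left.1 hFF hu'.1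
  have hwy : w ≠ y := fun h => hyF' (h ▸ hw'.1)
  have hxu : x ≠ u := fun h => hxF (h ▸ hu'.1)
  have hE4 := hE.insert (p := w) (q := y) (by simp [hwF]) (by simp [hyF, hyF'])
    (hV i₁ w hw'.2 y hy hwy)
  rw [← union_insert, insert_erase hw'.1] at hE4
  have hyu : u ≠ y := fun h => hyF (h ▸ hu'.1)
  have hE5 := hE4.insert (p := x) (q := u) (by simp [hxF, hxF']) (by simp [huF', hyu])
    (hV i₀ x hx u hu'.2 hxu)
  rwa [insert_comm, ← union_insert u, insert_erase hu'.1, union_comm F' F] at hE5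

/-- merging two closed sets via two families of `K₄⁻`-copies. -/
theorem stmt_9 (c : ℕ) (hc : 0 < c) (η ε : ℝ) (hη : 0 < η) (hε : 0 < ε) :
    ∃ η'₀ : ℝ, 0 < η'₀ ∧ ∀ η' : ℝ, 0 < η' → η' ≤ η'₀ →
      ∃ n₀ : ℕ, ∀ n : ℕ, n₀ ≤ n →
        ∀ H : Finset (Finset (Fin n)), Is3Graph n H →
          ∀ d : ℕ, ∀ hd2 : 2 ≤ d, d ≤ 4 →
            ∀ V : Fin d → Finset (Fin n),
              (∀ i j, i ≠ j → Disjoint (V i) (V j)) →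
              (∀ i, ClosedOn H c η (V i)) →
              ∀ a : Fin d → ℕ,
                1 ≤ a ⟨0, by omega⟩ → (∑ i, a i) = 4 →
                ε * (n : ℝ) ^ 4 ≤
                  ({S : Finset (Fin n) | SpansK4m H S ∧
                    ∀ i, (S ∩ V i).card = a i}.ncard : ℝ) →
                ε * (n : ℝ) ^ 4 ≤
                  ({S : Finset (Fin n) | SpansK4m H S ∧
                    (S ∩ V ⟨0, by omega⟩).card = a ⟨0, by omega⟩ - 1 ∧
                    (S ∩ V ⟨1, by omega⟩).card = a ⟨1, by omega⟩ + 1 ∧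
                    ∀ i : Fin d, 2 ≤ (i : ℕ) → (S ∩ V i).card = a i}.ncard : ℝ) →
                ClosedOn H (5 * c + 1) η' (V ⟨0, by omega⟩ ∪ V ⟨1, by omega⟩) := by
  classical
  obtain ⟨γA, hγA, nA, hA⟩ := conn_iter c hc η ε hη hε (4 * c + 1)
  obtain ⟨γ₁, hγ₁, n₁, hs1⟩ := step_lemma 0 4 (by omega) 1 ε one_pos hε
  obtain ⟨γ₂, hγ₂, n₂, hs2⟩ := step_lemma 4 4 (by omega) γ₁ ε hγ₁ hε
  obtain ⟨γ₃, hγ₃, n₃, hs3⟩ := ext_iter c hc η hη 5 8 γ₂ hγ₂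
  refine ⟨min γA γ₃, lt_min hγA hγ₃, ?_⟩
  intro η' _ hη'
  refine ⟨max nA (max n₁ (max n₂ n₃)), ?_⟩
  intro n hn H _ d hd2 _ V hdis hV a ha0 hsum hc1 hc2
  simp only [max_le_iff] at hn
  obtain ⟨hnA, hn1, hn2, hn3⟩ := hn
  have hηA : η' ≤ γA := hη'.trans (min_le_left _ _)
  have hη3 : η' ≤ γ₃ := hη'.trans (min_le_right _ _)
  have hcK : ε * (n : ℝ) ^ 4 ≤ ({S : Finset (Fin n) | SpansK4m H S}.ncard : ℝ) :=
    hc1.trans (ncard_mono' fun C hC => hC.1)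
  have hsame : ∀ i, ∀ x ∈ V i, ∀ y ∈ V i, x ≠ y → Close H (5 * c + 1) η' x y := by
    intro i x hx y hy hxy
    have := (hA n hnA H x y (hV i x hx y hy hxy) hcK).mono hηA
    have e : c + (4 * c + 1) = 5 * c + 1 := by ring
    rwa [e] at this
  have hcross : ∀ x ∈ V ⟨0, by omega⟩, ∀ y ∈ V ⟨1, by omega⟩, x ≠ y →
      Close H (5 * c + 1) η' x y := by
    intro x hx y hy hxy
    refine Close.mono ?_ hη3
    have k1 := hs1 n hn1 {x, y} card_le_two (fun A => A = ∅)
      (fun _ S => SpansK4m H S ∧ ∀ i, (S ∩ V i).card = a i)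
      (fun A hA => by rw [hA]; rfl) (fun A B _ hB => hB.1.1) (by simp) (fun _ _ => hc1)
    have k2 := hs2 n hn2 {x, y} card_le_two _
      (fun _ S => SpansK4m H S ∧
                    (S ∩ V ⟨0, by omega⟩).card = a ⟨0, by omega⟩ - 1 ∧
                    (S ∩ V ⟨1, by omega⟩).card = a ⟨1, by omega⟩ + 1 ∧
                    ∀ i : Fin d, 2 ≤ (i : ℕ) → (S ∩ V i).card = a i)
      (by
        rintro A ⟨A', B, rfl, hB, -, -, rfl⟩
        rw [empty_union]; exact hB.1.1) (fun A B _ hB => hB.1.1) k1 (fun _ _ => hc2)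
    have k3 := hs3 n hn3 H x y (k2.trans (ncard_mono' ?_))
    · have e : 8 + 5 * (4 * c - 1) = 4 * (5 * c + 1) - 1 := by omega
      rw [e] at k3
      refine k3.trans (ncard_mono' ?_)
      rintro C ⟨h1, h2, h3, h4⟩
      exact ⟨h2, h3, h1, h4.1, h4.2⟩
    · rintro C ⟨F, F', ⟨A', F2, rfl, hF, -, hFW, rfl⟩, hF', hFF, hFW', rfl⟩
      rw [empty_union] at hFF ⊢
      have hxF : x ∉ F2 := fun h => disjoint_left.1 hFW h (by simp)
      have hyF : y ∉ F2 := fun h => disjoint_left.1 hFW h (by simp)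
      have hxF' : x ∉ F' := fun h => disjoint_left.1 hFW' h (by simp)
      have hyF' : y ∉ F' := fun h => disjoint_left.1 hFW' h (by simp)
      refine ⟨?_, by simp [hxF, hxF'], by simp [hyF, hyF'], ?_⟩
      · rw [card_union_of_disjoint hFF.symm, hF.1.1, hF'.1.1]
      · refine ext_start hV hdis (i₀ := ⟨0, by omega⟩) (i₁ := ⟨1, by omega⟩) (by simp) ha0 hsum
          hF.1 hF.2 hF'.1 hF'.2.1 hF'.2.2.1 ?_ hFF.symm hxy hx hy hxF hxF' hyF hyF'
        intro i hi0 hi1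
        refine hF'.2.2.2 i ?_
        by_contra hlt
        have : (i : ℕ) = 0 ∨ (i : ℕ) = 1 := by omega
        rcases this with h | h
        · exact hi0 (Fin.ext h)
        · exact hi1 (Fin.ext h)
  intro x hx y hy hxy
  rcases mem_union.1 hx with hx | hx <;> rcases mem_union.1 hy with hy | hy
  · exact hsame _ x hx y hy hxy
  · exact hcross x hx y hy hxy
  · exact (hcross y hy x hx hxy.symm).symm
  · exact hsame _ x hx y hy hxy
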